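/- Let S be a C-semigroup in ℕ^d with full cone, let ≺ be a term order on ℕ^d such that every element of ℕ^d is preceded by only finitely many elements, and suppose S is ≺-almost symmetric. If |PF(S)| ≤ |{g ∈ S : g ≺ F(S)_≺}|, then S satisfies the extended Wilf inequality: |{g ∈ S : g ≺ F(S)_≺}|·e(S) ≥ N(F(S)_≺) + 1, where N(F(S)_≺) = |H(S)| + |{g ∈ S : g ≺ F(S)_≺}|. -/

import Mathlib

open Set

/-- Membership in the rational cone spanned by `S` inside `ℚ^d`. -/
def memCone {d : ℕ} (S : Set (Fin d → ℕ)) (x : Fin d → ℚ) : Prop :=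
  ∃ (n : ℕ) (c : Fin n → ℚ) (v : Fin n → (Fin d → ℕ)),
    (∀ i, 0 ≤ c i) ∧ (∀ i, v i ∈ S) ∧ x = ∑ i, c i • (fun j => ((v i j : ℚ)))

/-- `cone(S) ∩ ℕ^d`, viewed as a subset of `ℕ^d`. -/
def coneN {d : ℕ} (S : Set (Fin d → ℕ)) : Set (Fin d → ℕ) :=
  {x | memCone S (fun j => ((x j : ℚ)))}

/-- `H(S) = (cone(S) \ S) ∩ ℕ^d`. -/
def Hset {d : ℕ} (S : Set (Fin d → ℕ)) : Set (Fin d → ℕ) := coneN S \ S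

/-- The set of pseudo-Frobenius elements of `S`. -/
def pfSet {d : ℕ} (S : Set (Fin d → ℕ)) : Set (Fin d → ℕ) :=
  {f | f ∈ Hset S ∧ ∀ s ∈ S, s ≠ 0 → f + s ∈ S}

/-- A term order on `ℕ^d`: a strict total order compatible with addition. -/
def IsTermOrder {d : ℕ} (prec : (Fin d → ℕ) → (Fin d → ℕ) → Prop) : Prop :=
  (∀ a, ¬ prec a a) ∧ (∀ a b c, prec a b → prec b c → prec a c) ∧
    (∀ a b, a ≠ b → prec a b ∨ prec b a) ∧
    (∀ a b c, prec a b → prec (a + c) (b + c))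

/-- `F` is the maximum of `H(S)` with respect to the term order `prec`. -/
def IsFrob {d : ℕ} (S : Set (Fin d → ℕ)) (prec : (Fin d → ℕ) → (Fin d → ℕ) → Prop)
    (F : Fin d → ℕ) : Prop :=
  F ∈ Hset S ∧ ∀ h ∈ Hset S, h ≠ F → prec h F

/-- A `C`-semigroup: a finitely generated submonoid of `ℕ^d` with
`H(S)` nonempty and finite. -/
def CSemigroup {d : ℕ} (S : AddSubmonoid (Fin d → ℕ)) : Prop :=
  S.FG ∧ (Hset (S : Set (Fin d → ℕ))).Nonempty ∧ (Hset (S : Set (Fin d → ℕ))).Finite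

/-- `T` is an ideal of `S`: a subset of `cone(S) ∩ ℕ^d` with `S + T ⊆ T`. -/
def IsIdeal {d : ℕ} (S T : Set (Fin d → ℕ)) : Prop :=
  T ⊆ coneN S ∧ ∀ s ∈ S, ∀ t ∈ T, s + t ∈ T

/-- `Ω_≺ = {z ∈ cone(S) ∩ ℕ^d : F(S)_≺ − z ∉ S}` (the condition `F − z ∉ S`
is expressed as: there is no `w ∈ S` with `z + w = F`). -/
def omegaSet {d : ℕ} (S : Set (Fin d → ℕ)) (F : Fin d → ℕ) : Set (Fin d → ℕ) :=
  {z ∈ coneN S | ¬ ∃ w ∈ S, z + w = F}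

/-- `S` is `≺`-almost symmetric (with Frobenius element `F`):
`PF'(S) = PF(S) \ {F}` is nonempty and `F − g ∈ PF'(S)` for every `g ∈ PF'(S)`. -/
def AlmostSym {d : ℕ} (S : Set (Fin d → ℕ)) (F : Fin d → ℕ) : Prop :=
  (pfSet S \ {F}).Nonempty ∧ ∀ g ∈ pfSet S \ {F}, ∃ w ∈ pfSet S \ {F}, g + w = F

/-- The unique minimal generating set of a submonoid of `ℕ^d`:
the nonzero elements that are not sums of two nonzero elements. -/
def minGens {d : ℕ} (S : Set (Fin d → ℕ)) : Set (Fin d → ℕ) :=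
  {s ∈ S | s ≠ 0 ∧ ¬ ∃ x ∈ S, ∃ y ∈ S, x ≠ 0 ∧ y ≠ 0 ∧ x + y = s}

section Gaps

variable {d : ℕ} {S : AddSubmonoid (Fin d → ℕ)}

lemma sum_coord_pos {x : Fin d → ℕ} (hx : x ≠ 0) : 0 < ∑ i, x i := by
  by_contra hs
  apply hx
  funext i
  have h0 : ∑ i, x i = 0 := by omega
  exact Finset.sum_eq_zero_iff.1 h0 i (Finset.mem_univ i)

/-- Every gap lies below a pseudo-Frobenius element. -/
lemma exists_add_mem_pfSet (hfin : (Hset (S : Set (Fin d → ℕ))).Finite)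
    (hfull : coneN (S : Set (Fin d → ℕ)) = Set.univ) {x : Fin d → ℕ}
    (hx : x ∈ Hset (S : Set (Fin d → ℕ))) :
    ∃ s ∈ S, x + s ∈ pfSet (S : Set (Fin d → ℕ)) := by
  obtain ⟨f, ⟨hfH, s, hs, rfl⟩, hmax⟩ := Set.exists_max_image
    {f | f ∈ Hset (S : Set (Fin d → ℕ)) ∧ ∃ s ∈ S, x + s = f} (fun f => ∑ i, f i)
    (hfin.subset fun _ hf => hf.1) ⟨x, hx, 0, S.zero_mem, add_zero x⟩
  refine ⟨s, hs, hfH, fun r hr hr0 => ?_⟩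
  by_contra hn
  have hle := hmax (x + s + r)
    ⟨⟨hfull ▸ Set.mem_univ _, hn⟩, s + r, S.add_mem hs hr, (add_assoc _ _ _).symm⟩
  have hpos := sum_coord_pos hr0
  simp only [Pi.add_apply, Finset.sum_add_distrib] at hle
  omega

lemma frob_mem_pfSet (hfin : (Hset (S : Set (Fin d → ℕ))).Finite)
    (hfull : coneN (S : Set (Fin d → ℕ)) = Set.univ) {F : Fin d → ℕ}
    (hF : F ∈ Hset (S : Set (Fin d → ℕ))) (hAS : AlmostSym (S : Set (Fin d → ℕ)) F) :
    F ∈ pfSet (S : Set (Fin d → ℕ)) := by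
  obtain ⟨s, hs, hPF⟩ := exists_add_mem_pfSet hfin hfull hF
  by_cases hne : F + s = F
  · rwa [hne] at hPF
  · obtain ⟨w, -, hw⟩ := hAS.2 _ ⟨hPF, hne⟩
    rw [add_assoc, add_eq_left, add_eq_zero] at hw
    exact absurd (by rw [hw.1, add_zero]) hne

/-- A gap of an almost symmetric semigroup is symmetric to an element of the semigroup,
or is a pseudo-Frobenius element. -/
lemma exists_add_eq_or_mem_pfSet (hfin : (Hset (S : Set (Fin d → ℕ))).Finite)
    (hfull : coneN (S : Set (Fin d → ℕ)) = Set.univ) {F : Fin d → ℕ}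
    (hAS : AlmostSym (S : Set (Fin d → ℕ)) F) {x : Fin d → ℕ}
    (hx : x ∈ Hset (S : Set (Fin d → ℕ))) :
    (∃ s ∈ S, x + s = F) ∨ x ∈ pfSet (S : Set (Fin d → ℕ)) \ {F} := by
  obtain ⟨s, hs, hPF⟩ := exists_add_mem_pfSet hfin hfull hx
  by_cases hne : x + s = F
  · exact Or.inl ⟨s, hs, hne⟩
  · obtain ⟨w, hw, hwF⟩ := hAS.2 _ ⟨hPF, hne⟩
    by_cases hs0 : s = 0
    · subst hs0
      rw [add_zero] at hPF hne
      exact Or.inr ⟨hPF, hne⟩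
    · exact Or.inl ⟨w + s, hw.1.2 s hs hs0, by rw [← hwF]; abel⟩

lemma minGens_finite (hFG : S.FG) : (minGens (S : Set (Fin d → ℕ))).Finite := by
  obtain ⟨T, rfl⟩ := hFG
  refine T.finite_toSet.subset fun s hs => ?_
  have key : ∀ x ∈ AddSubmonoid.closure (T : Set (Fin d → ℕ)), x = 0 ∨ x ∈ T ∨
      ∃ y ∈ AddSubmonoid.closure (T : Set (Fin d → ℕ)),
      ∃ z ∈ AddSubmonoid.closure (T : Set (Fin d → ℕ)), y ≠ 0 ∧ z ≠ 0 ∧ y + z = x := by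
    intro x hx
    induction hx using AddSubmonoid.closure_induction with
    | mem x hx => exact Or.inr (Or.inl hx)
    | zero => exact Or.inl rfl
    | add x y hx hy ihx ihy =>
      by_cases hx0 : x = 0
      · simpa [hx0] using ihy
      by_cases hy0 : y = 0
      · simpa [hy0] using ihx
      exact Or.inr (Or.inr ⟨x, hx, y, hy, hx0, hy0, rfl⟩)
  rcases key s hs.1 with h0 | hT | hdec
  · exact absurd h0 hs.2.1
  · exact hT
  · exact absurd hdec hs.2.2

lemma mem_closure_minGens {s : Fin d → ℕ} (hs : s ∈ S) :
    s ∈ AddSubmonoid.closure (minGens (S : Set (Fin d → ℕ))) := by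
  induction hn : ∑ i, s i using Nat.strong_induction_on generalizing s with
  | _ n ih =>
    by_cases hs0 : s = 0
    · exact hs0 ▸ AddSubmonoid.zero_mem _
    by_cases hdec : ∃ x ∈ S, ∃ y ∈ S, x ≠ 0 ∧ y ≠ 0 ∧ x + y = s
    · obtain ⟨x, hx, y, hy, hx0, hy0, rfl⟩ := hdec
      have h1 := sum_coord_pos hx0
      have h2 := sum_coord_pos hy0
      simp only [Pi.add_apply, Finset.sum_add_distrib] at hn
      exact add_mem (ih _ (by omega) hx rfl) (ih _ (by omega) hy rfl)
    · exact AddSubmonoid.subset_closure ⟨hs, hs0, hdec⟩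

lemma minGens_nonempty (hne : (Hset (S : Set (Fin d → ℕ))).Nonempty) :
    (minGens (S : Set (Fin d → ℕ))).Nonempty := by
  by_contra hemp
  rw [Set.not_nonempty_iff_eq_empty] at hemp
  have hbot : ∀ s ∈ S, s = 0 := by
    intro s hs
    simpa [hemp] using mem_closure_minGens hs
  obtain ⟨x, ⟨n, c, v, -, hv, hx⟩, hxS⟩ := hne
  apply hxS
  have hx0 : x = 0 := by
    funext j
    have hj := congrFun hx j
    simpa [fun i => hbot (v i) (hv i)] using hj
  exact hx0 ▸ S.zero_mem

lemma exists_add_eq_nsmul {u v f : Fin d → ℕ} (hu : u ∈ S) (hu0 : u ≠ 0) (hv : v ∈ S)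
    (hgen : minGens (S : Set (Fin d → ℕ)) ⊆ {u, v}) (hf : f ∈ pfSet (S : Set (Fin d → ℕ))) :
    ∃ b : ℕ, f + u = b • v := by
  have hmem := AddSubmonoid.closure_mono hgen (mem_closure_minGens (hf.2 u hu hu0))
  obtain ⟨a, b, hab⟩ := (AddSubmonoid.mem_closure_pair _ _ _).1 hmem
  cases a with
  | zero => exact ⟨b, by simpa using hab.symm⟩
  | succ a =>
    refine absurd ?_ hf.1.2
    have hfe : f = a • u + b • v := by
      apply add_right_cancel (b := u)
      rw [← hab, succ_nsmul]
      abel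
    rw [hfe]
    exact S.add_mem (S.nsmul_mem hu a) (S.nsmul_mem hv b)

lemma pfSet_subsingleton_of_minGens_subset_pair {u v : Fin d → ℕ} (hu : u ∈ S) (hu0 : u ≠ 0)
    (hv : v ∈ S) (hv0 : v ≠ 0) (hgen : minGens (S : Set (Fin d → ℕ)) ⊆ {u, v}) :
    (pfSet (S : Set (Fin d → ℕ))).Subsingleton := by
  have key : ∀ f ∈ pfSet (S : Set (Fin d → ℕ)), ∀ g ∈ pfSet (S : Set (Fin d → ℕ)),
      ∀ a b : ℕ, f + u = a • v → g + u = b • v → a ≤ b → f = g := by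
    intro f hf g hg a b hfa hgb hab
    obtain ⟨k, rfl⟩ := Nat.exists_eq_add_of_le hab
    have hgf : g = f + k • v := by
      apply add_right_cancel (b := u)
      rw [hgb, add_nsmul, ← hfa]
      abel
    by_cases hk : k = 0
    · simpa [hk] using hgf.symm
    · refine absurd ?_ hg.1.2
      rw [hgf]
      exact hf.2 _ (S.nsmul_mem hv k) (smul_ne_zero hk hv0)
  intro f hf g hg
  obtain ⟨a, ha⟩ := exists_add_eq_nsmul hu hu0 hv hgen hf
  obtain ⟨b, hb⟩ := exists_add_eq_nsmul hu hu0 hv hgen hg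
  rcases le_total a b with hab | hab
  · exact key f hf g hg a b ha hb hab
  · exact (key g hg f hf b a hb ha hab).symm

lemma three_le_ncard_minGens (hFG : S.FG) (hne : (Hset (S : Set (Fin d → ℕ))).Nonempty)
    (hPF : (pfSet (S : Set (Fin d → ℕ))).Nontrivial) :
    3 ≤ (minGens (S : Set (Fin d → ℕ))).ncard := by
  by_contra! hlt
  have hfin := minGens_finite hFG
  obtain ⟨u, hu⟩ := minGens_nonempty hne
  have hpair : ∃ v ∈ minGens (S : Set (Fin d → ℕ)), minGens (S : Set (Fin d → ℕ)) ⊆ {u, v} := by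
    by_cases hex : ∃ v ∈ minGens (S : Set (Fin d → ℕ)), v ≠ u
    · obtain ⟨v, hv, hvu⟩ := hex
      refine ⟨v, hv, (Set.eq_of_subset_of_ncard_le (s := {u, v}) ?_ ?_ hfin).ge⟩
      · rintro x (rfl | rfl) <;> assumption
      · rw [Set.ncard_pair hvu.symm]
        omega
    · push Not at hex
      exact ⟨u, hu, fun x hx => Or.inl (hex x hx)⟩
  obtain ⟨v, hv, hgen⟩ := hpair
  exact Set.not_subsingleton_iff.2 hPF
    (pfSet_subsingleton_of_minGens_subset_pair hu.1 hu.2.1 hv.1 hv.2.1 hgen)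

end Gaps

lemma IsTermOrder.not_prec_zero {d : ℕ} {prec : (Fin d → ℕ) → (Fin d → ℕ) → Prop}
    (hprec : IsTermOrder prec) (hfin : {g | prec g 0}.Finite) (x : Fin d → ℕ) :
    ¬ prec x 0 := by
  intro hx
  have hx0 : x ≠ 0 := fun h0 => hprec.1 0 (h0 ▸ hx)
  have hmul : ∀ n : ℕ, prec ((n + 1) • x) 0 := by
    intro n
    induction n with
    | zero => simpa using hx
    | succ n ih =>
      have hstep := hprec.2.2.2 _ _ ((n + 1) • x) hx
      rw [zero_add] at hstep
      rw [succ_nsmul, add_comm]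
      exact hprec.2.1 _ _ _ hstep ih
  refine Set.infinite_of_injective_forall_mem (f := fun n : ℕ => (n + 1) • x) ?_ hmul hfin
  intro m n hmn
  obtain ⟨i, hi⟩ := Function.ne_iff.1 hx0
  have hmi := congrFun hmn i
  simp only [Pi.smul_apply, smul_eq_mul] at hmi
  have := Nat.eq_of_mul_eq_mul_right (Nat.pos_of_ne_zero hi) hmi
  omega

/-- The gaps symmetric to an element of `S` are at most as many as the elements of `S`
preceding the Frobenius element. -/
lemma ncard_symmetric_gaps_le {d : ℕ} {S : AddSubmonoid (Fin d → ℕ)}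
    {prec : (Fin d → ℕ) → (Fin d → ℕ) → Prop} (hprec : IsTermOrder prec)
    (hfin : ∀ x : Fin d → ℕ, {g | prec g x}.Finite) {F : Fin d → ℕ} (hF : F ∉ S) :
    {x : Fin d → ℕ | ∃ s ∈ S, x + s = F}.ncard ≤
      {g ∈ (S : Set (Fin d → ℕ)) | prec g F}.ncard := by
  refine Set.ncard_le_ncard_of_injOn (fun x => F - x) ?_ ?_
    ((hfin F).subset fun _ hg => hg.2)
  · rintro x ⟨s, hs, rfl⟩
    simp only [add_tsub_cancel_left]
    refine ⟨hs, ?_⟩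
    have hne : s ≠ x + s := fun he => hF (he ▸ hs)
    refine (hprec.2.2.1 _ _ hne).resolve_right fun hlt => ?_
    have hx0 : (0 : Fin d → ℕ) ≠ x := fun h0 => hne (by rw [← h0, zero_add])
    rcases hprec.2.2.1 _ _ hx0 with hpos | hneg
    · have hstep := hprec.2.2.2 _ _ s hpos
      rw [zero_add] at hstep
      exact hprec.1 _ (hprec.2.1 _ _ _ hstep hlt)
    · exact hprec.not_prec_zero (hfin 0) x hneg
  · rintro x ⟨s, -, hxs⟩ y ⟨r, -, hyr⟩ hxy
    simp only at hxy
    rw [← hxs, add_tsub_cancel_left, hxs, ← hyr, add_tsub_cancel_left] at hxy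
    subst hxy
    exact add_right_cancel (hxs.trans hyr.symm)

/-- Let `S` be a `≺`-almost symmetric `C`-semigroup with full cone,
where every element of `ℕ^d` is preceded by only finitely many elements. If
`|PF(S)| ≤ |{g ∈ S : g ≺ F}|`, then `S` satisfies the extended Wilf inequality
`|{g ∈ S : g ≺ F}|·e(S) ≥ |H(S)| + |{g ∈ S : g ≺ F}| + 1`. -/
theorem wilf_sufficient_cor {d : ℕ} (S : AddSubmonoid (Fin d → ℕ)) (hC : CSemigroup S)
    (hfull : coneN (S : Set (Fin d → ℕ)) = Set.univ)
    (prec : (Fin d → ℕ) → (Fin d → ℕ) → Prop) (hprec : IsTermOrder prec)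
    (hfin : ∀ x : Fin d → ℕ, {g | prec g x}.Finite)
    (F : Fin d → ℕ) (hF : IsFrob (S : Set (Fin d → ℕ)) prec F)
    (hAS : AlmostSym (S : Set (Fin d → ℕ)) F)
    (h : (pfSet (S : Set (Fin d → ℕ))).ncard ≤
        {g ∈ (S : Set (Fin d → ℕ)) | prec g F}.ncard) :
    (Hset (S : Set (Fin d → ℕ))).ncard +
        {g ∈ (S : Set (Fin d → ℕ)) | prec g F}.ncard + 1 ≤
      {g ∈ (S : Set (Fin d → ℕ)) | prec g F}.ncard *
        (minGens (S : Set (Fin d → ℕ))).ncard := by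
  obtain ⟨hFG, hne, hHfin⟩ := hC
  have hPFfin : (pfSet (S : Set (Fin d → ℕ))).Finite := hHfin.subset fun _ hf => hf.1
  have hFPF := frob_mem_pfSet hHfin hfull hF.1 hAS
  have he : 3 ≤ (minGens (S : Set (Fin d → ℕ))).ncard := by
    obtain ⟨g, hg, hgF⟩ := hAS.1
    exact three_le_ncard_minGens hFG hne ⟨g, hg, F, hFPF, hgF⟩
  have hsymfin : {x : Fin d → ℕ | ∃ s ∈ S, x + s = F}.Finite :=
    (Set.finite_Iic F).subset fun x ⟨s, _, hxs⟩ => by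
      rw [Set.mem_Iic, ← hxs]
      exact le_self_add
  have hcover : (Hset (S : Set (Fin d → ℕ))).ncard ≤
      {x : Fin d → ℕ | ∃ s ∈ S, x + s = F}.ncard + (pfSet (S : Set (Fin d → ℕ)) \ {F}).ncard :=
    (Set.ncard_le_ncard (fun _ hx => exists_add_eq_or_mem_pfSet hHfin hfull hAS hx)
      (hsymfin.union hPFfin.sdiff)).trans (Set.ncard_union_le _ _)
  have hsym := ncard_symmetric_gaps_le hprec hfin hF.1.2
  have hPF' := Set.ncard_sdiff_singleton_add_one hFPF hPFfin
  have hmul := Nat.mul_le_mul_left {g ∈ (S : Set (Fin d → ℕ)) | prec g F}.ncard he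
  omega
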